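/- (Uniquely ergodic weights.) Let Ω be a compact metric space and Θ: Ω → Ω a continuous map admitting exactly one Θ-invariant Borel probability measure. Let g: Ω → ℝ be continuous, let r ≥ 1, and let f: X → ℝ be continuous and depend only on the coordinates x_0,…,x_{r−1}. Then for every ω ∈ Ω and every λ ∈ ℝ the limit φ(λ) := lim_{n→∞} (1/n) log ∫_X exp(λ Σ_{k=0}^{n−1} g(Θ^k ω) f(T^k x)) dσ(x) exists, the limit is the same for all ω ∈ Ω, and λ ↦ φ(λ) is real-analytic on ℝ. -/

import Mathlib

open MeasureTheory Filter Finset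
open scoped ENNReal Topology

noncomputable section

/-- The shift map `T` on `ℕ → S`, `(Tx)_n = x_{n+1}`. -/
def shift {S : Type*} (x : ℕ → S) : ℕ → S := fun n => x (n + 1)

/-- The cylinder `[a_0, …, a_{m-1}]` of all `y` with `y_i = a_i` for `0 ≤ i < m`. -/
def cyl {S : Type*} {m : ℕ} (a : Fin m → S) : Set (ℕ → S) :=
  {y : ℕ → S | ∀ i : Fin m, y i = a i}

/-- The partial weighted Birkhoff sum `S_{m,n} f(x) = ∑_{k=m}^{n-1} f_k(T^k x)`. -/
def birk {S : Type*} (f : ℕ → (ℕ → S) → ℝ) (m n : ℕ) (x : ℕ → S) : ℝ :=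
  ∑ k ∈ Finset.Ico m n, f k (shift^[k] x)

/-- The partition function `Z_{m,n}(λ) = ∫ exp(λ S_{m,n}f) dσ`. -/
def Zmn {S : Type*} [MeasurableSpace S] (σ : Measure (ℕ → S))
    (f : ℕ → (ℕ → S) → ℝ) (lam : ℝ) (m n : ℕ) : ℝ :=
  ∫ x, Real.exp (lam * birk f m n x) ∂σ

/-- Hypothesis (H2): uniformly bounded distortion. -/
def H2 {S : Type*} (f : ℕ → (ℕ → S) → ℝ) (D : ℝ) : Prop :=
  ∀ N : ℕ, 1 ≤ N → ∀ x y : ℕ → S, (∀ i, i < N → x i = y i) →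
    ∑ k ∈ Finset.range N, |f k (shift^[k] x) - f k (shift^[k] y)| ≤ D

/-! ### Unique ergodicity -/

/-- Empirical measure along an orbit. -/
def empM {Ω : Type*} [MeasurableSpace Ω] (Θ : Ω → Ω) (ω : Ω) (n : ℕ) : Measure Ω :=
  ((n + 1 : ℕ) : ℝ≥0∞)⁻¹ • ∑ k ∈ Finset.range (n + 1), Measure.dirac (Θ^[k] ω)

lemma empM_prob {Ω : Type*} [MeasurableSpace Ω] (Θ : Ω → Ω) (ω : Ω) (n : ℕ) :
    IsProbabilityMeasure (empM Θ ω n) := by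
  constructor
  simp only [empM, Measure.smul_apply, Measure.finsetSum_apply, measure_univ, smul_eq_mul,
    Finset.sum_const, Finset.card_range, nsmul_eq_mul, mul_one]
  exact ENNReal.inv_mul_cancel (by simp) (ENNReal.natCast_ne_top _)

lemma integral_empM {Ω : Type*} [MetricSpace Ω] [CompactSpace Ω] [MeasurableSpace Ω] [BorelSpace Ω]
    (Θ : Ω → Ω) (ω : Ω) (n : ℕ) (h : Ω → ℝ) :
    ∫ x, h x ∂(empM Θ ω n) = (∑ k ∈ Finset.range (n + 1), h (Θ^[k] ω)) / ((n : ℝ) + 1) := by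
  rw [empM, integral_smul_measure, integral_finsetSum_measure]
  · rw [ENNReal.toReal_inv, ENNReal.toReal_natCast]
    simp only [integral_dirac, smul_eq_mul, div_eq_inv_mul, Nat.cast_add, Nat.cast_one]
  · intro i _
    exact integrable_dirac (by simp)

lemma ue_tendsto {Ω : Type*} [MetricSpace Ω] [CompactSpace Ω] [MeasurableSpace Ω] [BorelSpace Ω]
    (Θ : Ω → Ω) (hΘc : Continuous Θ) (m : ProbabilityMeasure Ω)
    (huniq : ∀ m' : ProbabilityMeasure Ω,
      MeasurePreserving Θ (m' : Measure Ω) (m' : Measure Ω) → m' = m)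
    (h : Ω → ℝ) (hh : Continuous h) (ω : Ω) :
    Tendsto (fun n : ℕ => (∑ k ∈ Finset.range (n + 1), h (Θ^[k] ω)) / ((n : ℝ) + 1)) atTop
      (𝓝 (∫ x, h x ∂(m : Measure Ω))) := by
  rw [tendsto_iff_ultrafilter]
  intro U hU
  let E : ℕ → ProbabilityMeasure Ω := fun n => ⟨empM Θ ω n, empM_prob Θ ω n⟩
  obtain ⟨ν, -, hν⟩ := isCompact_univ.ultrafilter_le_nhds (U.map E) (by simp)
  have hν' : Tendsto E U (𝓝 ν) := hν
  rw [ProbabilityMeasure.tendsto_iff_forall_integral_tendsto] at hν'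
  have key : ∀ u : Ω → ℝ, Continuous u →
      Tendsto (fun n : ℕ => (∑ k ∈ Finset.range (n + 1), u (Θ^[k] ω)) / ((n : ℝ) + 1)) U
      (𝓝 (∫ x, u x ∂(ν : Measure Ω))) := by
    intro u hu
    have := hν' (BoundedContinuousFunction.mkOfCompact ⟨u, hu⟩)
    refine this.congr fun n => ?_
    exact integral_empM Θ ω n u
  have hinv : MeasurePreserving Θ (ν : Measure Ω) (ν : Measure Ω) := by
    refine ⟨hΘc.measurable, ?_⟩
    have : IsProbabilityMeasure (Measure.map Θ (ν : Measure Ω)) :=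
      Measure.isProbabilityMeasure_map hΘc.measurable.aemeasurable
    refine ext_of_forall_integral_eq_of_IsFiniteMeasure fun u => ?_
    rw [integral_map hΘc.measurable.aemeasurable u.continuous.aestronglyMeasurable]
    have h1 := key (fun x => u (Θ x)) (u.continuous.comp hΘc)
    have h2 := key u u.continuous
    have h3 : Tendsto (fun n : ℕ => (u (Θ^[n+1] ω) - u ω) / ((n : ℝ) + 1)) U (𝓝 0) := by
      refine Tendsto.mono_left ?_ hU
      have h4 : Tendsto (fun n : ℕ => (2 * ‖u‖) * (1 / ((n : ℝ) + 1))) atTop (𝓝 0) := by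
        simpa using tendsto_one_div_add_atTop_nhds_zero_nat.const_mul (2 * ‖u‖)
      refine squeeze_zero_norm (fun n => ?_) h4
      rw [norm_div, div_eq_mul_one_div]
      have : ‖((n : ℝ) + 1)‖ = (n : ℝ) + 1 := Real.norm_of_nonneg (by positivity)
      rw [this]
      gcongr
      have := u.norm_coe_le_norm (Θ^[n+1] ω)
      have := u.norm_coe_le_norm ω
      exact (norm_sub_le _ _).trans (by linarith)
    have h5 := h2.add h3
    rw [add_zero] at h5
    refine tendsto_nhds_unique h1 (h5.congr fun n => ?_)
    rw [← add_div]
    congr 1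
    have e1 := Finset.sum_range_succ (fun k => u (Θ^[k] ω)) (n + 1)
    rw [Finset.sum_range_succ'] at e1
    simp only [Function.iterate_succ', Function.comp, Function.iterate_zero, id] at e1 ⊢
    linarith
  rw [← huniq ν hinv]
  exact key h hh

/-- Quasi-additive sequences over a uniquely ergodic system. -/
lemma quasi_additive_limit {Ω : Type*} [MetricSpace Ω] [CompactSpace Ω] [MeasurableSpace Ω]
    [BorelSpace Ω] (Θ : Ω → Ω) (hΘc : Continuous Θ) (m : ProbabilityMeasure Ω)
    (huniq : ∀ m' : ProbabilityMeasure Ω,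
      MeasurePreserving Θ (m' : Measure Ω) (m' : Measure Ω) → m' = m)
    (a : ℕ → Ω → ℝ) (C D : ℝ) (hD : 0 ≤ D) (hac : ∀ n, Continuous (a n))
    (hab : ∀ n ω, |a n ω| ≤ C * n)
    (hadd : ∀ n k ω, |a (n + k) ω - a n ω - a k (Θ^[n] ω)| ≤ D) :
    ∃ L : ℝ, ∀ ω, Tendsto (fun n : ℕ => a n ω / n) atTop (𝓝 L) := by
  have hbasic : ∀ N n ω, |N * a n ω - ∑ k ∈ Finset.range n, a N (Θ^[k] ω)|
      ≤ n * D + N * (2 * (C * N) + D) := by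
    intro N n ω
    have e1 : |∑ k ∈ Finset.range n, (a (k + N) ω - a k ω - a N (Θ^[k] ω))| ≤ n * D := by
      refine (Finset.abs_sum_le_sum_abs _ _).trans ?_
      refine (Finset.sum_le_sum fun k _ => hadd k N ω).trans ?_
      simp
    have e2 : ∑ k ∈ Finset.range n, (a (k + N) ω - a k ω)
        = ∑ j ∈ Finset.range N, (a (n + j) ω - a j ω) := by
      have h1 := Finset.sum_range_add (fun k => a k ω) N n
      have h2 := Finset.sum_range_add (fun k => a k ω) n N
      rw [Finset.sum_sub_distrib, Finset.sum_sub_distrib]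
      rw [add_comm N n] at h1
      simp only [add_comm N] at h1
      linarith
    have e3 : |∑ j ∈ Finset.range N, (a (n + j) ω - a j ω - a n ω)| ≤ N * (2 * (C * N) + D) := by
      refine (Finset.abs_sum_le_sum_abs _ _).trans ?_
      have : ∀ j ∈ Finset.range N, |a (n + j) ω - a j ω - a n ω| ≤ 2 * (C * N) + D := by
        intro j hj
        have hjN : (j : ℝ) ≤ N := by exact_mod_cast (Finset.mem_range.1 hj).le
        have hC : 0 ≤ C := by
          have := (abs_nonneg _).trans (hab 1 ω); simpa using this
        have hCj : C * j ≤ C * N := mul_le_mul_of_nonneg_left hjN hC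
        have h1 := abs_le.1 (hadd n j ω)
        have h2 := abs_le.1 (hab j ω)
        have h3 := abs_le.1 (hab j (Θ^[n] ω))
        rw [abs_le]
        constructor <;> linarith
      refine (Finset.sum_le_sum this).trans ?_
      rw [Finset.sum_const, Finset.card_range, nsmul_eq_mul]
    rw [Finset.sum_sub_distrib, e2] at e1
    rw [Finset.sum_sub_distrib, Finset.sum_const, Finset.card_range, nsmul_eq_mul] at e3
    rw [abs_le] at *
    constructor <;> linarith
  -- divide
  have hdiv : ∀ N : ℕ, 0 < N → ∀ ω, ∀ ε > 0, ∀ᶠ n : ℕ in atTop,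
      |a n ω / n - (∫ x, a N x ∂(m : Measure Ω)) / N| ≤ D / N + ε := by
    intro N hN ω ε hε
    set I := ∫ x, a N x ∂(m : Measure Ω)
    have hN' : (0 : ℝ) < N := by exact_mod_cast hN
    have hav := ue_tendsto Θ hΘc m huniq (a N) (hac N) ω
    have hav' : Tendsto (fun n : ℕ => (∑ k ∈ Finset.range n, a N (Θ^[k] ω)) / (n : ℝ)) atTop
        (𝓝 I) := by
      rw [← tendsto_add_atTop_iff_nat 1]
      simpa using hav
    have h1 := (Metric.tendsto_nhds.1 hav') (N * (ε / 2)) (by positivity)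
    have h2 : Tendsto (fun n : ℕ => (2 * (C * N) + D) / (n : ℝ)) atTop (𝓝 0) :=
      tendsto_const_div_atTop_nhds_zero_nat _
    have h3 := (tendsto_order.1 h2).2 (ε / 2) (by positivity)
    filter_upwards [h1, h3, eventually_gt_atTop 0] with n hn1 hn3 hn0
    have hn' : (0 : ℝ) < n := by exact_mod_cast hn0
    have hb := hbasic N n ω
    set Sg := ∑ k ∈ Finset.range n, a N (Θ^[k] ω)
    rw [Real.dist_eq] at hn1
    have e1 : |a n ω / n - Sg / n / N| ≤ D / N + (2 * (C * N) + D) / n := by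
      have : a n ω / n - Sg / n / N = (N * a n ω - Sg) / (n * N) := by field_simp
      rw [this, abs_div, abs_of_pos (mul_pos hn' hN'), div_le_iff₀ (mul_pos hn' hN')]
      refine hb.trans (le_of_eq ?_)
      field_simp
    have e2 : |Sg / n / N - I / N| ≤ ε / 2 := by
      rw [← sub_div, abs_div, abs_of_pos hN', div_le_iff₀ hN']
      linarith
    have := abs_sub_le (a n ω / n) (Sg / n / N) (I / N)
    linarith
  -- Cauchy
  have hlim : ∀ ω, ∃ L, Tendsto (fun n : ℕ => a n ω / n) atTop (𝓝 L) := by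
    intro ω
    apply cauchySeq_tendsto_of_complete
    rw [Metric.cauchySeq_iff']
    intro ε hε
    obtain ⟨N, hN⟩ := exists_nat_gt (4 * D / ε)
    have hN' : (0 : ℝ) < N := lt_of_le_of_lt (by positivity) hN
    have hDN : D / N < ε / 4 := by
      rw [div_lt_iff₀ hε] at hN
      rw [div_lt_iff₀ hN']; linarith
    obtain ⟨n0, hn0⟩ := eventually_atTop.1 (hdiv N (by exact_mod_cast hN') ω (ε / 8) (by positivity))
    refine ⟨n0, fun n hn => ?_⟩
    have h1 := abs_le.1 (hn0 n hn)
    have h2 := abs_le.1 (hn0 n0 le_rfl)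
    rw [Real.dist_eq, abs_lt]
    constructor <;> linarith
  choose L hL using hlim
  have hLI : ∀ ω, ∀ N : ℕ, 0 < N → |L ω - (∫ x, a N x ∂(m : Measure Ω)) / N| ≤ D / N := by
    intro ω N hN
    refine le_of_forall_pos_le_add fun ε hε => ?_
    exact le_of_tendsto ((hL ω).sub_const _).abs (hdiv N hN ω ε hε)
  have hconst : ∀ ω ω', L ω = L ω' := by
    intro ω ω'
    have hz : Tendsto (fun N : ℕ => D / (N : ℝ) + D / (N : ℝ)) atTop (𝓝 (0 + 0)) :=
      (tendsto_const_div_atTop_nhds_zero_nat D).add (tendsto_const_div_atTop_nhds_zero_nat D)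
    have : |L ω - L ω'| ≤ 0 + 0 := by
      refine ge_of_tendsto hz ?_
      filter_upwards [eventually_gt_atTop 0] with N hN
      have h1 := abs_le.1 (hLI ω N hN)
      have h2 := abs_le.1 (hLI ω' N hN)
      rw [abs_le]
      constructor <;> linarith
    have := abs_nonpos_iff.1 (by simpa using this : |L ω - L ω'| ≤ 0)
    linarith
  have : Nonempty Ω := by
    by_contra hne
    rw [not_nonempty_iff] at hne
    have := (inferInstance : IsProbabilityMeasure (m : Measure Ω)).measure_univ
    simp [Set.eq_empty_of_isEmpty] at this
  obtain ⟨ω0⟩ := this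
  exact ⟨L ω0, fun ω => hconst ω ω0 ▸ hL ω⟩

/-! ### A Vitali type lemma -/

lemma vitali_real (h : ℕ → ℂ → ℂ) (φ : ℝ → ℝ) (t δ B : ℝ) (hδ : 0 < δ)
    (hd : ∀ m, DifferentiableOn ℂ (h m) (Metric.ball (t : ℂ) δ))
    (hB : ∀ m, ∀ z ∈ Metric.ball (t : ℂ) δ, ‖h m z‖ ≤ B)
    (hlim : ∀ x : ℝ, |x - t| < δ → Tendsto (fun m => (h m x).re) atTop (𝓝 (φ x))) :
    AnalyticAt ℝ φ t := by
  set ρ := δ / 2 with hρ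
  have hρ0 : 0 < ρ := by positivity
  let A : ℕ → ℕ → ℂ := fun m k => ((k.factorial : ℂ))⁻¹ * iteratedDeriv k (h m) t
  have hA : ∀ m k, ‖A m k‖ ≤ B / ρ ^ k := by
    intro m k
    have hsub : Metric.closedBall (t : ℂ) ρ ⊆ Metric.ball (t : ℂ) δ :=
      Metric.closedBall_subset_ball (by linarith)
    have h1 := Complex.norm_iteratedDeriv_le_of_forall_mem_sphere_norm_le (c := (t : ℂ)) (R := ρ)
      (C := B) (f := h m) k hρ0
      (DifferentiableOn.diffContOnCl_ball (hd m) hsub)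
      (fun z hz => hB m z (hsub (Metric.sphere_subset_closedBall hz)))
    have hf : (0 : ℝ) < k.factorial := by exact_mod_cast k.factorial_pos
    simp only [A, norm_mul, norm_inv, Complex.norm_natCast]
    rw [inv_mul_le_iff₀ hf]
    exact h1.trans (le_of_eq (by ring))
  let U : Ultrafilter ℕ := Ultrafilter.of atTop
  have hU : (U : Filter ℕ) ≤ atTop := Ultrafilter.of_le _
  have hex : ∀ k, ∃ a : ℂ, Tendsto (fun m => A m k) U (𝓝 a) := by
    intro k
    obtain ⟨a, -, ha⟩ := (isCompact_closedBall (0 : ℂ) (B / ρ ^ k)).ultrafilter_le_nhds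
      (U.map fun m => A m k) (by
        rw [le_principal_iff, Ultrafilter.coe_map, Filter.mem_map]
        exact univ_mem' fun m => by simpa using hA m k)
    exact ⟨a, ha⟩
  choose a ha using hex
  have hB0 : 0 ≤ B := (norm_nonneg _).trans (hB 0 t (Metric.mem_ball_self hδ))
  have hsum : ∀ y : ℝ, |y| < ρ → HasSum (fun k => y ^ k * (a k).re) (φ (t + y)) := by
    intro y hy
    have hbd : Summable (fun k : ℕ => B * (|y| / ρ) ^ k) :=
      (summable_geometric_of_lt_one (by positivity) ((div_lt_one hρ0).2 hy)).mul_left B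
    have hbound : ∀ m k, ‖y ^ k * (A m k).re‖ ≤ B * (|y| / ρ) ^ k := by
      intro m k
      rw [norm_mul, norm_pow, Real.norm_eq_abs, Real.norm_eq_abs, div_pow]
      have := (Complex.abs_re_le_norm (A m k)).trans (hA m k)
      calc |y| ^ k * |(A m k).re| ≤ |y| ^ k * (B / ρ ^ k) := by gcongr
        _ = _ := by ring
    have hTk : ∀ k, Tendsto (fun m => y ^ k * (A m k).re) U (𝓝 (y ^ k * (a k).re)) := fun k =>
      ((Complex.continuous_re.tendsto _).comp (ha k)).const_mul _
    have hT := tendsto_tsum_of_dominated_convergence (𝓕 := (U : Filter ℕ)) hbd hTk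
      (Eventually.of_forall fun m k => hbound m k)
    have hlim' : Tendsto (fun m => (h m ((t + y : ℝ) : ℂ)).re) U (𝓝 (φ (t + y))) :=
      (hlim (t + y) (by rw [add_sub_cancel_left]; linarith)).mono_left hU
    have hval : ∀ m, ∑' k, y ^ k * (A m k).re = (h m ((t + y : ℝ) : ℂ)).re := by
      intro m
      have hz : ((t + y : ℝ) : ℂ) ∈ Metric.ball (t : ℂ) δ := by
        rw [mem_ball_iff_norm]
        simp only [Complex.ofReal_add, add_sub_cancel_left, Complex.norm_real, Real.norm_eq_abs]
        linarith
      have h1 := Complex.hasSum_taylorSeries_on_ball (hd m) hz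
      have h2 := Complex.hasSum_re h1
      rw [← h2.tsum_eq]
      congr 1
      ext k
      have : ((k.factorial : ℂ)⁻¹ • (((t + y : ℝ) : ℂ) - t) ^ k • iteratedDeriv k (h m) t)
          = ((y ^ k : ℝ) : ℂ) * A m k := by
        simp only [A, smul_eq_mul]
        push_cast
        ring
      rw [this, Complex.re_ofReal_mul]
    simp only [hval] at hT
    rw [tendsto_nhds_unique hlim' hT]
    refine (Summable.of_norm_bounded hbd fun k => ?_).hasSum
    exact le_of_tendsto (hTk k).norm (Eventually.of_forall fun m => hbound m k)
  refine ⟨FormalMultilinearSeries.ofScalars ℝ fun k => (a k).re, ?_⟩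
  rw [hasFPowerSeriesAt_iff]
  filter_upwards [Metric.ball_mem_nhds (0 : ℝ) hρ0] with y hy
  have := hsum y (by simpa using hy)
  simpa [FormalMultilinearSeries.coeff_ofScalars] using this

/-! ### Complex cone contraction -/

lemma cont_integrable {X E : Type*} [TopologicalSpace X] [CompactSpace X] [MeasurableSpace X]
    [OpensMeasurableSpace X] [SecondCountableTopology X] [NormedAddCommGroup E]
    (σ : Measure X) [IsFiniteMeasure σ] {u : X → E} (hu : Continuous u) : Integrable u σ :=
  hu.integrable_of_hasCompactSupport (HasCompactSupport.of_compactSpace u)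

lemma cone_step {X : Type*} [TopologicalSpace X] [CompactSpace X] [MeasurableSpace X]
    [OpensMeasurableSpace X] [SecondCountableTopology X] (σ : Measure X) [IsProbabilityMeasure σ]
    (P : X → ℝ) (F : X → ℂ) (hP : Continuous P) (hF : Continuous F) (hPpos : ∀ y, 0 < P y)
    (s : X → X → ℝ) (hs : ∀ x, Continuous (s x)) (A : ℝ) (hsA : ∀ x y, |s x y| ≤ A)
    (l : ℝ) (z : ℂ) (τ d : ℝ) (hτ : τ = Real.exp (-(2 * (|l| * A))))
    (hd : ∀ x y, ‖Complex.exp (z * s x y) - Real.exp (l * s x y)‖ ≤ d * Real.exp (l * s x y))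
    (hd0 : 0 ≤ d) (hdτ : d ≤ τ / 10) (hA : 0 ≤ A)
    (κ : ℂ) (hκ : κ ≠ 0) (hcone : ∀ y, ‖F y - κ * P y‖ ≤ 1 / 4 * ‖κ‖ * P y) :
    ∃ κ' : ℂ, κ' ≠ 0 ∧
      (∀ x, ‖(∫ y, Complex.exp (z * s x y) * F y ∂σ)
          - κ' * ((∫ y, Real.exp (l * s x y) * P y ∂σ : ℝ) : ℂ)‖
        ≤ 1 / 4 * ‖κ'‖ * ∫ y, Real.exp (l * s x y) * P y ∂σ) ∧
      (∀ x, ‖(∫ y, Complex.exp (z * s x y) * F y ∂σ)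
          - κ * ((∫ y, Real.exp (l * s x y) * P y ∂σ : ℝ) : ℂ)‖
        ≤ 3 / 8 * ‖κ‖ * ∫ y, Real.exp (l * s x y) * P y ∂σ) := by
  have hτ0 : 0 < τ := hτ ▸ Real.exp_pos _
  have hτ1 : τ ≤ 1 := by rw [hτ, Real.exp_le_one_iff]; have := abs_nonneg l; nlinarith
  set p := ∫ y, P y ∂σ with hp
  have hPint : Integrable P σ := cont_integrable σ hP
  have hFint : Integrable F σ := cont_integrable σ hF
  have hNe : Nonempty X := by
    by_contra hne
    rw [not_nonempty_iff] at hne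
    have := (inferInstance : IsProbabilityMeasure σ).measure_univ
    simp [Set.eq_empty_of_isEmpty] at this
  have hp0 : 0 < p := by
    obtain ⟨y0, hy0⟩ := hP.exists_forall_le_of_hasCompactSupport (HasCompactSupport.of_compactSpace P)
    calc 0 < P y0 := hPpos y0
      _ = ∫ _, P y0 ∂σ := by simp
      _ ≤ p := integral_mono (integrable_const _) hPint hy0
  have hpC : (p : ℂ) ≠ 0 := by exact_mod_cast hp0.ne'
  set P' : X → ℝ := fun x => ∫ y, Real.exp (l * s x y) * P y ∂σ with hP'
  set G : X → ℂ := fun y => F y - κ * P y with hG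
  have hGc : Continuous G := by
    simp only [hG]; fun_prop
  have hκn : 0 < ‖κ‖ := norm_pos_iff.2 hκ
  have hFle : ∀ y, ‖F y‖ ≤ 5 / 4 * ‖κ‖ * P y := by
    intro y
    have h1 : F y = G y + κ * P y := by simp [hG]
    rw [h1]
    refine (norm_add_le _ _).trans ?_
    rw [norm_mul, Complex.norm_real, Real.norm_of_nonneg (hPpos y).le]
    have := hcone y
    simp only [hG]
    linarith
  have hi1 : ∀ x, Integrable (fun y => Real.exp (l * s x y) * P y) σ := fun x =>
    cont_integrable σ (by have := hs x; fun_prop)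
  have hi2 : ∀ x, Integrable (fun y => Complex.exp (z * s x y) * F y) σ := fun x =>
    cont_integrable σ (by have := hs x; fun_prop)
  have hi3 : ∀ x, Integrable (fun y => (Real.exp (l * s x y) : ℂ) * G y) σ := fun x =>
    cont_integrable σ (by have := hs x; fun_prop)
  have hi4 : ∀ x, Integrable (fun y => (Complex.exp (z * s x y) - Real.exp (l * s x y)) * F y) σ :=
    fun x => cont_integrable σ (by have := hs x; fun_prop)
  have hP'0 : ∀ x, 0 ≤ P' x := fun x =>
    integral_nonneg fun y => mul_nonneg (Real.exp_pos _).le (hPpos y).le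
  -- decomposition
  have hdec : ∀ x, (∫ y, Complex.exp (z * s x y) * F y ∂σ) - κ * (P' x : ℂ)
      = (∫ y, (Real.exp (l * s x y) : ℂ) * G y ∂σ)
        + ∫ y, (Complex.exp (z * s x y) - Real.exp (l * s x y)) * F y ∂σ := by
    intro x
    have h1 : κ * (P' x : ℂ) = ∫ y, κ * ((Real.exp (l * s x y) * P y : ℝ) : ℂ) ∂σ := by
      rw [integral_const_mul, integral_complex_ofReal]
    have hi5 : Integrable (fun y => κ * ((Real.exp (l * s x y) * P y : ℝ) : ℂ)) σ :=
      cont_integrable σ (by have := hs x; fun_prop)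
    rw [h1, ← integral_sub (hi2 x) hi5, ← integral_add (hi3 x) (hi4 x)]
    congr 1
    ext y
    simp only [hG]
    push_cast
    ring
  have herr : ∀ x, ‖∫ y, (Complex.exp (z * s x y) - Real.exp (l * s x y)) * F y ∂σ‖
      ≤ d * (5 / 4) * ‖κ‖ * P' x := by
    intro x
    rw [hP', ← integral_const_mul]
    refine norm_integral_le_of_norm_le ((hi1 x).const_mul _) (Eventually.of_forall fun y => ?_)
    rw [norm_mul]
    calc _ ≤ (d * Real.exp (l * s x y)) * (5 / 4 * ‖κ‖ * P y) :=
          mul_le_mul (hd x y) (hFle y) (norm_nonneg _) (by positivity)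
      _ = _ := by ring
  have hG1 : ∀ x, ‖∫ y, (Real.exp (l * s x y) : ℂ) * G y ∂σ‖ ≤ 1 / 4 * ‖κ‖ * P' x := by
    intro x
    rw [hP', ← integral_const_mul]
    refine norm_integral_le_of_norm_le ((hi1 x).const_mul _) (Eventually.of_forall fun y => ?_)
    rw [norm_mul, Complex.norm_real, Real.norm_of_nonneg (Real.exp_pos _).le]
    calc _ ≤ Real.exp (l * s x y) * (1 / 4 * ‖κ‖ * P y) := by
          gcongr; exact hcone y
      _ = _ := by ring
  have hIG : ‖∫ y, G y ∂σ‖ ≤ 1 / 4 * ‖κ‖ * p := by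
    rw [hp, ← integral_const_mul]
    exact norm_integral_le_of_norm_le (hPint.const_mul _) (Eventually.of_forall hcone)
  -- Doeblin
  have hDoe : ∀ x y, τ * (P' x / p) ≤ Real.exp (l * s x y) := by
    intro x y
    have hls : ∀ y, |l * s x y| ≤ |l| * A := fun y => by
      rw [abs_mul]; exact mul_le_mul_of_nonneg_left (hsA x y) (abs_nonneg _)
    have h1 : P' x ≤ Real.exp (|l| * A) * p := by
      rw [hp, ← integral_const_mul]
      refine integral_mono (hi1 x) (hPint.const_mul _) fun y => ?_
      have := (abs_le.1 (hls y)).2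
      exact mul_le_mul_of_nonneg_right (Real.exp_le_exp.2 this) (hPpos y).le
    have h2 : P' x / p ≤ Real.exp (|l| * A) := by rwa [div_le_iff₀ hp0]
    calc τ * (P' x / p) ≤ τ * Real.exp (|l| * A) := by gcongr
      _ = Real.exp (-(|l| * A)) := by rw [hτ, ← Real.exp_add]; congr 1; ring
      _ ≤ _ := Real.exp_le_exp.2 (abs_le.1 (hls y)).1
  have hmain : ∀ x, ‖(∫ y, (Real.exp (l * s x y) : ℂ) * G y ∂σ)
      - ((τ * (P' x / p) : ℝ) : ℂ) * ∫ y, G y ∂σ‖ ≤ (1 - τ) * (1 / 4) * ‖κ‖ * P' x := by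
    intro x
    have hGi : Integrable G σ := cont_integrable σ hGc
    rw [← integral_const_mul, ← integral_sub (hi3 x) (hGi.const_mul _)]
    have e : (1 - τ) * (1 / 4) * ‖κ‖ * P' x
        = ∫ y, (Real.exp (l * s x y) * P y - τ * (P' x / p) * P y) * (1 / 4 * ‖κ‖) ∂σ := by
      rw [integral_mul_const, integral_sub (hi1 x) (hPint.const_mul _), integral_const_mul,
        ← hp]
      have : τ * (P' x / p) * p = τ * P' x := by field_simp
      rw [this]
      simp only [hP']
      ring
    rw [e]
    refine norm_integral_le_of_norm_le
      (((hi1 x).sub (hPint.const_mul _)).mul_const _) (Eventually.of_forall fun y => ?_)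
    rw [← sub_mul, ← Complex.ofReal_sub, norm_mul, Complex.norm_real,
      Real.norm_of_nonneg (sub_nonneg.2 (hDoe x y))]
    calc _ ≤ (Real.exp (l * s x y) - τ * (P' x / p)) * (1 / 4 * ‖κ‖ * P y) :=
          mul_le_mul_of_nonneg_left (hcone y) (sub_nonneg.2 (hDoe x y))
      _ = _ := by ring
  -- the new centre
  set κ' : ℂ := κ + (τ / p : ℝ) * ∫ y, G y ∂σ with hκ'
  have hκ'n : (1 - τ / 4) * ‖κ‖ ≤ ‖κ'‖ := by
    have h1 : ‖((τ / p : ℝ) : ℂ) * ∫ y, G y ∂σ‖ ≤ τ / 4 * ‖κ‖ := by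
      rw [norm_mul, Complex.norm_real, Real.norm_of_nonneg (by positivity)]
      calc _ ≤ τ / p * (1 / 4 * ‖κ‖ * p) := by gcongr
        _ = _ := by field_simp
    have h2 : ‖κ‖ ≤ ‖κ'‖ + ‖((τ / p : ℝ) : ℂ) * ∫ y, G y ∂σ‖ := by
      have : κ = κ' - ((τ / p : ℝ) : ℂ) * ∫ y, G y ∂σ := by rw [hκ']; ring
      calc ‖κ‖ = ‖κ' - ((τ / p : ℝ) : ℂ) * ∫ y, G y ∂σ‖ := by rw [← this]
        _ ≤ _ := norm_sub_le _ _
    linarith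
  refine ⟨κ', ?_, ?_, ?_⟩
  · rw [← norm_pos_iff]
    refine lt_of_lt_of_le ?_ hκ'n
    apply mul_pos _ hκn
    linarith
  · intro x
    change ‖_ - κ' * (P' x : ℂ)‖ ≤ _ * P' x
    have e : (∫ y, Complex.exp (z * s x y) * F y ∂σ) - κ' * (P' x : ℂ)
        = ((∫ y, (Real.exp (l * s x y) : ℂ) * G y ∂σ)
            - ((τ * (P' x / p) : ℝ) : ℂ) * ∫ y, G y ∂σ)
          + ∫ y, (Complex.exp (z * s x y) - Real.exp (l * s x y)) * F y ∂σ := by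
      have := hdec x
      rw [sub_add_eq_add_sub, ← this, hκ']
      push_cast
      ring
    rw [e]
    refine (norm_add_le _ _).trans ((add_le_add (hmain x) (herr x)).trans ?_)
    have h3 : (1 - τ) * (1 / 4) * ‖κ‖ + d * (5 / 4) * ‖κ‖ ≤ 1 / 4 * ‖κ'‖ := by
      have : (1 - τ) * (1 / 4) + d * (5 / 4) ≤ 1 / 4 * (1 - τ / 4) := by linarith
      nlinarith
    nlinarith [hP'0 x]
  · intro x
    change ‖_ - κ * (P' x : ℂ)‖ ≤ _ * P' x
    rw [hdec x]
    refine (norm_add_le _ _).trans ((add_le_add (hG1 x) (herr x)).trans ?_)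
    have h3 : 1 / 4 * ‖κ‖ + d * (5 / 4) * ‖κ‖ ≤ 3 / 8 * ‖κ‖ := by
      have : d ≤ 1 / 10 := by linarith
      nlinarith
    nlinarith [hP'0 x]

lemma ratio_bound (Z Z' κ : ℂ) (p p' : ℝ) (hp : 0 < p) (hp' : 0 < p') (hκ : κ ≠ 0)
    (h1 : ‖Z - κ * p‖ ≤ 1 / 4 * ‖κ‖ * p) (h2 : ‖Z' - κ * p'‖ ≤ 3 / 8 * ‖κ‖ * p') :
    Z ≠ 0 ∧ Z' / Z * ((p / p' : ℝ) : ℂ) ∈ Metric.closedBall (1 : ℂ) (5 / 6) := by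
  have hκn : 0 < ‖κ‖ := norm_pos_iff.2 hκ
  have hZ : 3 / 4 * ‖κ‖ * p ≤ ‖Z‖ := by
    have : ‖κ * p‖ ≤ ‖Z‖ + ‖Z - κ * p‖ := by
      have e : κ * p = Z - (Z - κ * p) := by ring
      calc ‖κ * p‖ = ‖Z - (Z - κ * p)‖ := by rw [← e]
        _ ≤ _ := norm_sub_le _ _
    rw [norm_mul, Complex.norm_real, Real.norm_of_nonneg hp.le] at this
    linarith
  have hZ0 : 0 < ‖Z‖ := lt_of_lt_of_le (by positivity) hZ
  have hZne : Z ≠ 0 := norm_pos_iff.1 hZ0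
  refine ⟨hZne, ?_⟩
  rw [mem_closedBall_iff_norm]
  have hpc : (p' : ℂ) ≠ 0 := by exact_mod_cast hp'.ne'
  have e : Z' / Z * ((p / p' : ℝ) : ℂ) - 1
      = ((Z' - κ * p') * p - (Z - κ * p) * p') / (Z * p') := by
    push_cast
    field_simp
    ring
  rw [e, norm_div, norm_mul, Complex.norm_real, Real.norm_of_nonneg hp'.le,
    div_le_iff₀ (by positivity)]
  refine (norm_sub_le _ _).trans ?_
  rw [norm_mul, norm_mul, Complex.norm_real, Complex.norm_real, Real.norm_of_nonneg hp'.le,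
    Real.norm_of_nonneg hp.le]
  have a1 := mul_le_mul_of_nonneg_right h1 hp'.le
  have a2 := mul_le_mul_of_nonneg_right h2 hp.le
  have a3 := mul_le_mul_of_nonneg_right hZ hp'.le
  nlinarith

/-! ### Gluing and the Bernoulli measure -/

/-- The first `n` letters of `y` followed by `x`. -/
def glue {S : Type*} (n : ℕ) (y x : ℕ → S) : ℕ → S := fun i => if i < n then y i else x (i - n)

lemma shift_iter {S : Type*} (k : ℕ) (x : ℕ → S) (i : ℕ) : (shift^[k] x) i = x (i + k) := by
  induction k generalizing x i with
  | zero => rfl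
  | succ k ih =>
    rw [Function.iterate_succ_apply, ih]
    simp only [shift]
    congr 1

lemma shift_glue {S : Type*} (n : ℕ) (y x : ℕ → S) : shift^[n] (glue n y x) = x := by
  ext i
  rw [shift_iter]
  simp [glue]

lemma glue_assoc {S : Type*} (n r : ℕ) (y v x : ℕ → S) :
    glue (n + r) (glue n y v) x = glue n y (glue r v x) := by
  ext i
  simp only [glue]
  by_cases h1 : i < n
  · simp [h1, Nat.lt_add_right r h1]
  · by_cases h2 : i < n + r
    · have h3 : i - n < r := by omega
      simp [h1, h2, h3]
    · have h3 : ¬ (i - n < r) := by omega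
      simp only [h1, h2, h3, if_false]
      congr 1
      omega

lemma continuous_glue {S : Type*} [TopologicalSpace S] (n : ℕ) :
    Continuous (fun p : (ℕ → S) × (ℕ → S) => glue n p.1 p.2) := by
  refine continuous_pi fun i => ?_
  simp only [glue]
  split_ifs
  · exact (continuous_apply i).comp continuous_fst
  · exact (continuous_apply (i - n)).comp continuous_snd

lemma continuous_shift_iter {S : Type*} [TopologicalSpace S] (k : ℕ) :
    Continuous (fun x : ℕ → S => shift^[k] x) := by
  refine continuous_pi fun i => ?_
  simp only [shift_iter]
  exact continuous_apply _

lemma glue_measurePreserving {S : Type*} [Fintype S] [TopologicalSpace S]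
    [DiscreteTopology S] [MeasurableSpace S] [BorelSpace S]
    (σ : Measure (ℕ → S)) [IsProbabilityMeasure σ]
    (hσ : ∀ (m : ℕ) (a : Fin m → S), σ (cyl a) = (Fintype.card S : ℝ≥0∞)⁻¹ ^ m) (n : ℕ) :
    MeasurePreserving (fun p : (ℕ → S) × (ℕ → S) => glue n p.1 p.2) (σ.prod σ) σ := by
  have hmeas : Measurable (fun p : (ℕ → S) × (ℕ → S) => glue n p.1 p.2) :=
    (continuous_glue n).measurable
  refine ⟨hmeas, ?_⟩
  have hcyl : ∀ (x : ℕ → S) (m : ℕ), σ (PiNat.cylinder x m) = (Fintype.card S : ℝ≥0∞)⁻¹ ^ m := by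
    intro x m
    rw [← hσ m (fun i => x i)]
    congr 1
    ext y
    simp only [PiNat.cylinder, cyl, Set.mem_ofPred_eq]
    exact ⟨fun h i => h i i.2, fun h i hi => h ⟨i, hi⟩⟩
  have : IsProbabilityMeasure
      (Measure.map (fun p : (ℕ → S) × (ℕ → S) => glue n p.1 p.2) (σ.prod σ)) :=
    Measure.isProbabilityMeasure_map hmeas.aemeasurable
  have hbasis := PiNat.isTopologicalBasis_cylinders (fun _ : ℕ => S)
  refine ext_of_generate_finite
    { s : Set (ℕ → S) | ∃ (x : ℕ → S) (n : ℕ), s = PiNat.cylinder x n } ?_ ?_ ?_ ?_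
  · rw [BorelSpace.measurable_eq (α := ℕ → S)]
    exact hbasis.borel_eq_generateFrom
  · rintro _ ⟨x, k, rfl⟩ _ ⟨y, l, rfl⟩ ⟨w, hw1, hw2⟩
    refine ⟨w, max k l, ?_⟩
    ext u
    simp only [PiNat.cylinder, Set.mem_inter_iff, Set.mem_ofPred_eq] at *
    constructor
    · rintro ⟨h1, h2⟩ i hi
      rcases lt_max_iff.1 hi with h | h
      · rw [h1 i h, hw1 i h]
      · rw [h2 i h, hw2 i h]
    · intro h
      exact ⟨fun i hi => by rw [h i (lt_max_of_lt_left hi), hw1 i hi],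
        fun i hi => by rw [h i (lt_max_of_lt_right hi), hw2 i hi]⟩
  · rintro _ ⟨x, m, rfl⟩
    rw [Measure.map_apply hmeas (PiNat.isOpen_cylinder _ x m).measurableSet]
    have : (fun p : (ℕ → S) × (ℕ → S) => glue n p.1 p.2) ⁻¹' PiNat.cylinder x m
        = PiNat.cylinder x (min m n) ×ˢ PiNat.cylinder (fun i => x (i + n)) (m - n) := by
      ext ⟨y, v⟩
      simp only [PiNat.cylinder, Set.mem_preimage, Set.mem_ofPred_eq, Set.mem_prod, glue]
      constructor
      · intro h
        refine ⟨fun i hi => ?_, fun i hi => ?_⟩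
        · have h1 := h i (lt_of_lt_of_le hi (min_le_left _ _))
          rwa [if_pos (lt_of_lt_of_le hi (min_le_right _ _))] at h1
        · have h1 := h (i + n) (by omega)
          rwa [if_neg (by omega), Nat.add_sub_cancel] at h1
      · rintro ⟨h1, h2⟩ i hi
        split_ifs with hin
        · exact h1 i (lt_min hi hin)
        · have := h2 (i - n) (by omega)
          rwa [Nat.sub_add_cancel (by omega)] at this
    rw [this, Measure.prod_prod, hcyl, hcyl, hcyl, ← pow_add]
    congr 1
    omega
  · simp

/-- Weighted Birkhoff sums. -/
def Sn {S : Type*} (c : ℕ → ℝ) (f : (ℕ → S) → ℝ) (n : ℕ) (x : ℕ → S) : ℝ :=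
  ∑ k ∈ Finset.range n, c k * f (shift^[k] x)

lemma continuous_Sn {S : Type*} [TopologicalSpace S] (c : ℕ → ℝ) (f : (ℕ → S) → ℝ)
    (hf : Continuous f) (n : ℕ) : Continuous (Sn c f n) := by
  unfold Sn
  refine continuous_finsetSum _ fun k _ => ?_
  exact continuous_const.mul (hf.comp (continuous_shift_iter k))

lemma Sn_add {S : Type*} (c : ℕ → ℝ) (f : (ℕ → S) → ℝ) (n m : ℕ) (x : ℕ → S) :
    Sn c f (n + m) x = Sn c f n x + Sn (fun k => c (n + k)) f m (shift^[n] x) := by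
  unfold Sn
  rw [Finset.sum_range_add]
  congr 1
  refine Finset.sum_congr rfl fun k _ => ?_
  rw [add_comm n k, Function.iterate_add_apply, add_comm k n]

lemma Sn_bound {S : Type*} (c : ℕ → ℝ) (f : (ℕ → S) → ℝ) (G M : ℝ)
    (hc : ∀ k, |c k| ≤ G) (hM : ∀ x, |f x| ≤ M) (n : ℕ) (x : ℕ → S) :
    |Sn c f n x| ≤ n * (G * M) := by
  unfold Sn
  refine (Finset.abs_sum_le_sum_abs _ _).trans ?_
  have : ∀ k ∈ Finset.range n, |c k * f (shift^[k] x)| ≤ G * M := fun k _ => by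
    rw [abs_mul]
    exact mul_le_mul (hc k) (hM _) (abs_nonneg _) ((abs_nonneg _).trans (hc k))
  refine (Finset.sum_le_sum this).trans ?_
  simp

lemma Sn_glue_close {S : Type*} (c : ℕ → ℝ) (f : (ℕ → S) → ℝ) (G M : ℝ)
    (hc : ∀ k, |c k| ≤ G) (hM : ∀ x, |f x| ≤ M) (r : ℕ)
    (hfr : ∀ x y : ℕ → S, (∀ i, i < r → x i = y i) → f x = f y) (n : ℕ) (y x : ℕ → S) :
    |Sn c f n (glue n y x) - Sn c f n y| ≤ r * (2 * (G * M)) := by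
  have hG : 0 ≤ G := (abs_nonneg _).trans (hc 0)
  have hM0 : 0 ≤ M := (abs_nonneg _).trans (hM y)
  have hkey : ∀ k, k + r ≤ n → f (shift^[k] (glue n y x)) = f (shift^[k] y) := by
    intro k hk
    refine hfr _ _ fun i hi => ?_
    rw [shift_iter, shift_iter, glue, if_pos (by omega)]
  unfold Sn
  rw [← Finset.sum_sub_distrib]
  refine (Finset.abs_sum_le_sum_abs _ _).trans ?_
  have h1 : ∀ k ∈ Finset.range n, |c k * f (shift^[k] (glue n y x)) - c k * f (shift^[k] y)|
      ≤ if n < k + r then 2 * (G * M) else 0 := by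
    intro k _
    split_ifs with h
    · rw [← mul_sub, abs_mul]
      have a1 := abs_le.1 (hM (shift^[k] (glue n y x)))
      have a2 := abs_le.1 (hM (shift^[k] y))
      have a3 : |f (shift^[k] (glue n y x)) - f (shift^[k] y)| ≤ 2 * M := by
        rw [abs_le]; constructor <;> linarith
      calc _ ≤ G * (2 * M) := mul_le_mul (hc k) a3 (abs_nonneg _) hG
        _ = _ := by ring
    · rw [hkey k (by omega)]; simp
  refine (Finset.sum_le_sum h1).trans ?_
  rw [← Finset.sum_filter, Finset.sum_const, nsmul_eq_mul]
  have hcard : ((Finset.range n).filter fun k => n < k + r).card ≤ r := by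
    have : ((Finset.range n).filter fun k => n < k + r) ⊆ Finset.Ico (n - r) n := by
      intro k hk
      rw [Finset.mem_filter, Finset.mem_range] at hk
      rw [Finset.mem_Ico]
      omega
    refine (Finset.card_le_card this).trans ?_
    rw [Nat.card_Ico]
    omega
  have : (((Finset.range n).filter fun k => n < k + r).card : ℝ) ≤ r := by exact_mod_cast hcard
  exact mul_le_mul_of_nonneg_right this (by positivity)

lemma continuous_integral_param {Y X E : Type*} [TopologicalSpace Y] [FirstCountableTopology Y]
    [LocallyCompactSpace Y] [TopologicalSpace X] [CompactSpace X] [MeasurableSpace X]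
    [OpensMeasurableSpace X] [SecondCountableTopology X] [NormedAddCommGroup E] [NormedSpace ℝ E]
    (σ : Measure X) [IsProbabilityMeasure σ] (u : Y → X → E)
    (hu : Continuous (Function.uncurry u)) : Continuous fun y => ∫ x, u y x ∂σ := by
  have := continuous_parametric_integral_of_continuous (μ := σ) hu isCompact_univ
  simpa using this

section Bern
set_option linter.unusedSectionVars false
variable {S : Type*} [Fintype S] [TopologicalSpace S]
    [DiscreteTopology S] [MeasurableSpace S] [BorelSpace S]
    (σ : Measure (ℕ → S)) [IsProbabilityMeasure σ]

/-- Real partition function. -/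
def Zr (c : ℕ → ℝ) (f : (ℕ → S) → ℝ) (l : ℝ) (n : ℕ) : ℝ :=
  ∫ x, Real.exp (l * Sn c f n x) ∂σ

/-- Iterates of the complex transfer operators. -/
def Fc (c : ℕ → ℝ) (f : (ℕ → S) → ℝ) (z : ℂ) (n : ℕ) (x : ℕ → S) : ℂ :=
  ∫ y, Complex.exp (z * (Sn c f n (glue n y x) : ℝ)) ∂σ

/-- Complex partition function. -/
def Zc (c : ℕ → ℝ) (f : (ℕ → S) → ℝ) (z : ℂ) (n : ℕ) : ℂ :=
  ∫ x, Complex.exp (z * (Sn c f n x : ℝ)) ∂σ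

/-- Iterates of the real transfer operators. -/
def Pr (c : ℕ → ℝ) (f : (ℕ → S) → ℝ) (l : ℝ) (n : ℕ) (x : ℕ → S) : ℝ :=
  ∫ y, Real.exp (l * Sn c f n (glue n y x)) ∂σ

lemma Fc_ofReal (c : ℕ → ℝ) (f : (ℕ → S) → ℝ) (l : ℝ) (n : ℕ) (x : ℕ → S) :
    Fc σ c f l n x = (Pr σ c f l n x : ℂ) := by
  unfold Fc Pr
  rw [← integral_complex_ofReal]
  simp

lemma Zc_ofReal (c : ℕ → ℝ) (f : (ℕ → S) → ℝ) (l : ℝ) (n : ℕ) :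
    Zc σ c f l n = (Zr σ c f l n : ℂ) := by
  unfold Zc Zr
  rw [← integral_complex_ofReal]
  simp

lemma Fc_continuous (c : ℕ → ℝ) (f : (ℕ → S) → ℝ) (hf : Continuous f) (z : ℂ) (n : ℕ) :
    Continuous (Fc σ c f z n) := by
  unfold Fc
  refine continuous_integral_param σ _ ?_
  have h1 := continuous_Sn c f hf n
  have h2 : Continuous fun p : (ℕ → S) × (ℕ → S) => glue n p.2 p.1 :=
    (continuous_glue n).comp continuous_swap
  have h3 := h1.comp h2
  exact Complex.continuous_exp.comp (continuous_const.mul (Complex.continuous_ofReal.comp h3))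

lemma Pr_continuous (c : ℕ → ℝ) (f : (ℕ → S) → ℝ) (hf : Continuous f) (l : ℝ) (n : ℕ) :
    Continuous (Pr σ c f l n) := by
  have h := Complex.continuous_re.comp (Fc_continuous σ c f hf l n)
  refine h.congr fun x => ?_
  simp [Fc_ofReal]

lemma Pr_pos (c : ℕ → ℝ) (f : (ℕ → S) → ℝ) (hf : Continuous f) (l : ℝ) (n : ℕ) (x : ℕ → S) :
    0 < Pr σ c f l n x := by
  have h2 : Continuous fun y : ℕ → S => glue n y x :=
    (continuous_glue n).comp (continuous_id.prodMk continuous_const)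
  refine integral_exp_pos (cont_integrable σ ?_)
  exact Real.continuous_exp.comp (continuous_const.mul ((continuous_Sn c f hf n).comp h2))

lemma Zr_pos (c : ℕ → ℝ) (f : (ℕ → S) → ℝ) (hf : Continuous f) (l : ℝ) (n : ℕ) :
    0 < Zr σ c f l n := by
  refine integral_exp_pos (cont_integrable σ ?_)
  exact Real.continuous_exp.comp (continuous_const.mul (continuous_Sn c f hf n))

lemma integral_glue
    (hσ : ∀ (m : ℕ) (a : Fin m → S), σ (cyl a) = (Fintype.card S : ℝ≥0∞)⁻¹ ^ m)
    {E : Type*} [NormedAddCommGroup E] [NormedSpace ℝ E] (n : ℕ)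
    (u : (ℕ → S) → E) (hu : Continuous u) :
    ∫ x, u x ∂σ = ∫ x, ∫ y, u (glue n y x) ∂σ ∂σ := by
  have hmp := glue_measurePreserving σ hσ n
  have h1 : ∫ p, u (glue n p.1 p.2) ∂(σ.prod σ) = ∫ x, u x ∂σ := by
    conv_rhs => rw [← hmp.map_eq]
    rw [integral_map hmp.measurable.aemeasurable]
    exact hu.aestronglyMeasurable
  rw [← h1, integral_prod_symm (fun p : (ℕ → S) × (ℕ → S) => u (glue n p.1 p.2))]
  exact cont_integrable _ (hu.comp (continuous_glue n))

lemma Zc_eq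
    (hσ : ∀ (m : ℕ) (a : Fin m → S), σ (cyl a) = (Fintype.card S : ℝ≥0∞)⁻¹ ^ m)
    (c : ℕ → ℝ) (f : (ℕ → S) → ℝ) (hf : Continuous f) (z : ℂ) (n : ℕ) :
    Zc σ c f z n = ∫ x, Fc σ c f z n x ∂σ := by
  unfold Zc Fc
  refine integral_glue σ hσ n (fun x => Complex.exp (z * (Sn c f n x : ℝ))) ?_
  have := continuous_Sn c f hf n
  fun_prop

lemma Zr_eq
    (hσ : ∀ (m : ℕ) (a : Fin m → S), σ (cyl a) = (Fintype.card S : ℝ≥0∞)⁻¹ ^ m)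
    (c : ℕ → ℝ) (f : (ℕ → S) → ℝ) (hf : Continuous f) (l : ℝ) (n : ℕ) :
    Zr σ c f l n = ∫ x, Pr σ c f l n x ∂σ := by
  unfold Zr Pr
  refine integral_glue σ hσ n (fun x => Real.exp (l * Sn c f n x)) ?_
  have := continuous_Sn c f hf n
  fun_prop

lemma Fc_rec
    (hσ : ∀ (m : ℕ) (a : Fin m → S), σ (cyl a) = (Fintype.card S : ℝ≥0∞)⁻¹ ^ m)
    (c : ℕ → ℝ) (f : (ℕ → S) → ℝ) (hf : Continuous f) (r : ℕ)
    (hfr : ∀ x y : ℕ → S, (∀ i, i < r → x i = y i) → f x = f y) (z : ℂ) (n : ℕ) (x : ℕ → S) :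
    Fc σ c f z (n + r) x
      = ∫ v, Complex.exp (z * (Sn (fun k => c (n + k)) f r (glue r v x) : ℝ)) * Fc σ c f z n v ∂σ := by
  have h2 : Continuous fun y : ℕ → S => glue (n + r) y x :=
    (continuous_glue (n + r)).comp (continuous_id.prodMk continuous_const)
  conv_lhs => unfold Fc
  rw [integral_glue σ hσ n]
  · congr 1
    ext v
    unfold Fc
    rw [← integral_const_mul]
    congr 1
    ext y
    rw [glue_assoc, Sn_add, shift_glue]
    have : Sn c f n (glue n y (glue r v x)) = Sn c f n (glue n y v) := by
      unfold Sn
      refine Finset.sum_congr rfl fun k hk => ?_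
      rw [Finset.mem_range] at hk
      congr 1
      refine hfr _ _ fun i hi => ?_
      rw [shift_iter, shift_iter]
      simp only [glue]
      split_ifs with h1 h2
      · rfl
      · rfl
      · omega
    rw [this, ← Complex.exp_add]
    congr 1
    push_cast
    ring
  · have := (continuous_Sn c f hf (n + r)).comp h2
    exact Complex.continuous_exp.comp (continuous_const.mul (Complex.continuous_ofReal.comp this))

lemma Pr_rec
    (hσ : ∀ (m : ℕ) (a : Fin m → S), σ (cyl a) = (Fintype.card S : ℝ≥0∞)⁻¹ ^ m)
    (c : ℕ → ℝ) (f : (ℕ → S) → ℝ) (hf : Continuous f) (r : ℕ)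
    (hfr : ∀ x y : ℕ → S, (∀ i, i < r → x i = y i) → f x = f y) (l : ℝ) (n : ℕ) (x : ℕ → S) :
    Pr σ c f l (n + r) x
      = ∫ v, Real.exp (l * Sn (fun k => c (n + k)) f r (glue r v x)) * Pr σ c f l n v ∂σ := by
  have h := Fc_rec σ hσ c f hf r hfr l n x
  rw [Fc_ofReal] at h
  have h' : ∀ v, Complex.exp ((l : ℂ) * (Sn (fun k => c (n + k)) f r (glue r v x) : ℝ))
      * Fc σ c f l n v
      = ((Real.exp (l * Sn (fun k => c (n + k)) f r (glue r v x)) * Pr σ c f l n v : ℝ) : ℂ) := by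
    intro v
    rw [Fc_ofReal]
    push_cast
    rfl
  simp only [h'] at h
  rw [integral_complex_ofReal] at h
  exact_mod_cast h

lemma Zr_quasi
    (hσ : ∀ (m : ℕ) (a : Fin m → S), σ (cyl a) = (Fintype.card S : ℝ≥0∞)⁻¹ ^ m)
    (c : ℕ → ℝ) (f : (ℕ → S) → ℝ) (hf : Continuous f) (G M : ℝ)
    (hc : ∀ k, |c k| ≤ G) (hM : ∀ x, |f x| ≤ M) (r : ℕ)
    (hfr : ∀ x y : ℕ → S, (∀ i, i < r → x i = y i) → f x = f y) (l : ℝ) (n k : ℕ) :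
    |Real.log (Zr σ c f l (n + k)) - Real.log (Zr σ c f l n)
      - Real.log (Zr σ (fun j => c (n + j)) f l k)| ≤ |l| * (r * (2 * (G * M))) := by
  set D := |l| * (r * (2 * (G * M))) with hD
  set c' : ℕ → ℝ := fun j => c (n + j) with hc'
  have hSn := continuous_Sn c f hf n
  have hSk := continuous_Sn c' f hf k
  have hSnk := continuous_Sn c f hf (n + k)
  have hg := continuous_glue (S := S) n
  have e0 : Zr σ c f l (n + k)
      = ∫ p, Real.exp (l * Sn c f (n + k) (glue n p.1 p.2)) ∂(σ.prod σ) := by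
    have hmp := glue_measurePreserving σ hσ n
    unfold Zr
    conv_lhs => rw [← hmp.map_eq]
    rw [integral_map hmp.measurable.aemeasurable]
    exact (Real.continuous_exp.comp (continuous_const.mul hSnk)).aestronglyMeasurable
  have e1 : Zr σ c f l n * Zr σ c' f l k
      = ∫ p : (ℕ → S) × (ℕ → S), Real.exp (l * Sn c f n p.1) * Real.exp (l * Sn c' f k p.2)
          ∂(σ.prod σ) := by
    unfold Zr
    rw [integral_prod_mul (fun x => Real.exp (l * Sn c f n x)) (fun x => Real.exp (l * Sn c' f k x))]
  have i0 : Integrable (fun p : (ℕ → S) × (ℕ → S) =>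
      Real.exp (l * Sn c f (n + k) (glue n p.1 p.2))) (σ.prod σ) := by
    refine cont_integrable _ ?_
    exact Real.continuous_exp.comp (continuous_const.mul (hSnk.comp hg))
  have i1 : Integrable (fun p : (ℕ → S) × (ℕ → S) =>
      Real.exp (l * Sn c f n p.1) * Real.exp (l * Sn c' f k p.2)) (σ.prod σ) := by
    refine cont_integrable _ ?_
    fun_prop
  have hpt : ∀ p : (ℕ → S) × (ℕ → S),
      |l * Sn c f (n + k) (glue n p.1 p.2) - (l * Sn c f n p.1 + l * Sn c' f k p.2)| ≤ D := by
    rintro ⟨y, x⟩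
    have h1 := Sn_glue_close c f G M hc hM r hfr n y x
    rw [Sn_add, shift_glue]
    have : l * (Sn c f n (glue n y x) + Sn c' f k x) - (l * Sn c f n y + l * Sn c' f k x)
        = l * (Sn c f n (glue n y x) - Sn c f n y) := by ring
    simp only
    rw [this, abs_mul]
    exact mul_le_mul_of_nonneg_left h1 (abs_nonneg _)
  have up : Zr σ c f l (n + k) ≤ Real.exp D * (Zr σ c f l n * Zr σ c' f l k) := by
    rw [e0, e1, ← integral_const_mul]
    refine integral_mono i0 (i1.const_mul _) fun p => ?_
    simp only
    rw [← Real.exp_add, ← Real.exp_add, Real.exp_le_exp]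
    linarith [(abs_le.1 (hpt p)).2]
  have lo : Real.exp (-D) * (Zr σ c f l n * Zr σ c' f l k) ≤ Zr σ c f l (n + k) := by
    rw [e0, e1, ← integral_const_mul]
    refine integral_mono (i1.const_mul _) i0 fun p => ?_
    simp only
    rw [← Real.exp_add, ← Real.exp_add, Real.exp_le_exp]
    linarith [(abs_le.1 (hpt p)).1]
  have p1 := Zr_pos σ c f hf l n
  have p2 := Zr_pos σ c' f hf l k
  have p3 := Zr_pos σ c f hf l (n + k)
  have l1 := Real.log_le_log p3 up
  have l2 := Real.log_le_log (by positivity) lo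
  rw [Real.log_mul (Real.exp_pos _).ne' (by positivity), Real.log_exp,
    Real.log_mul p1.ne' p2.ne'] at l1 l2
  rw [abs_le]
  constructor <;> linarith

lemma Zr_bound (c : ℕ → ℝ) (f : (ℕ → S) → ℝ) (hf : Continuous f) (G M : ℝ)
    (hc : ∀ k, |c k| ≤ G) (hM : ∀ x, |f x| ≤ M) (l : ℝ) (n : ℕ) :
    |Real.log (Zr σ c f l n)| ≤ |l| * (G * M) * n := by
  have hSn := continuous_Sn c f hf n
  have hpt : ∀ x, |l * Sn c f n x| ≤ |l| * (G * M) * n := fun x => by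
    rw [abs_mul]
    have := Sn_bound c f G M hc hM n x
    calc _ ≤ |l| * (n * (G * M)) := mul_le_mul_of_nonneg_left this (abs_nonneg _)
      _ = _ := by ring
  have hi : Integrable (fun x => Real.exp (l * Sn c f n x)) σ :=
    cont_integrable σ (by fun_prop)
  have up : Zr σ c f l n ≤ Real.exp (|l| * (G * M) * n) := by
    have := integral_mono hi (integrable_const (Real.exp (|l| * (G * M) * n)))
      (fun x => Real.exp_le_exp.2 (abs_le.1 (hpt x)).2)
    simpa [Zr] using this
  have lo : Real.exp (-(|l| * (G * M) * n)) ≤ Zr σ c f l n := by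
    have := integral_mono (integrable_const (Real.exp (-(|l| * (G * M) * n)))) hi
      (fun x => Real.exp_le_exp.2 (abs_le.1 (hpt x)).1)
    simpa [Zr] using this
  have l1 := Real.log_le_log (Zr_pos σ c f hf l n) up
  have l2 := Real.log_le_log (Real.exp_pos _) lo
  rw [Real.log_exp] at l1 l2
  exact abs_le.2 ⟨l2, l1⟩

end Bern

section Bern2
set_option linter.unusedSectionVars false
variable {S : Type*} [Fintype S] [TopologicalSpace S]
    [DiscreteTopology S] [MeasurableSpace S] [BorelSpace S]
    (σ : Measure (ℕ → S)) [IsProbabilityMeasure σ]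

lemma Zc_differentiable (c : ℕ → ℝ) (f : (ℕ → S) → ℝ) (hf : Continuous f) (n : ℕ) :
    Differentiable ℂ (fun z => Zc σ c f z n) := by
  intro z
  have hSn := continuous_Sn c f hf n
  have huniv : ProbabilityTheory.integrableExpSet (Sn c f n) σ = Set.univ := by
    ext t
    simp only [ProbabilityTheory.integrableExpSet, Set.mem_ofPred_eq, Set.mem_univ, iff_true]
    exact cont_integrable σ (by fun_prop)
  have := ProbabilityTheory.hasDerivAt_complexMGF (X := Sn c f n) (μ := σ) (z := z)
    (by rw [huniv]; simp)
  exact this.differentiableAt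

lemma ratio_mem
    (hσ : ∀ (m : ℕ) (a : Fin m → S), σ (cyl a) = (Fintype.card S : ℝ≥0∞)⁻¹ ^ m)
    (c : ℕ → ℝ) (f : (ℕ → S) → ℝ) (hf : Continuous f) (G M : ℝ)
    (hc : ∀ k, |c k| ≤ G) (hM : ∀ x, |f x| ≤ M) (r : ℕ)
    (hfr : ∀ x y : ℕ → S, (∀ i, i < r → x i = y i) → f x = f y) (l : ℝ) :
    ∃ δ > 0, ∀ z ∈ Metric.ball (l : ℂ) δ, ∀ m : ℕ, Zc σ c f z (m * r) ≠ 0 ∧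
      Zc σ c f z ((m + 1) * r) / Zc σ c f z (m * r)
        * ((Zr σ c f l (m * r) / Zr σ c f l ((m + 1) * r) : ℝ) : ℂ)
        ∈ Metric.closedBall (1 : ℂ) (5 / 6) := by
  have hNe : Nonempty (ℕ → S) := by
    by_contra hne
    rw [not_nonempty_iff] at hne
    have := (inferInstance : IsProbabilityMeasure σ).measure_univ
    simp [Set.eq_empty_of_isEmpty] at this
  obtain ⟨x0⟩ := hNe
  have hG0 : 0 ≤ G := (abs_nonneg _).trans (hc 0)
  have hM0 : 0 ≤ M := (abs_nonneg _).trans (hM x0)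
  set A : ℝ := r * (G * M) with hA
  have hA0 : 0 ≤ A := by positivity
  set τ : ℝ := Real.exp (-(2 * (|l| * A))) with hτ
  have hτ0 : 0 < τ := Real.exp_pos _
  have hτ1 : τ ≤ 1 := by rw [hτ, Real.exp_le_one_iff]; have := abs_nonneg l; nlinarith
  refine ⟨τ / (20 * (A + 1)), by positivity, fun z hz => ?_⟩
  rw [mem_ball_iff_norm] at hz
  set s : ℕ → (ℕ → S) → (ℕ → S) → ℝ :=
    fun m x v => Sn (fun k => c (m * r + k)) f r (glue r v x) with hs
  have hsA : ∀ m x v, |s m x v| ≤ A := fun m x v =>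
    Sn_bound _ f G M (fun k => hc _) hM r _
  have hsc : ∀ m x, Continuous (s m x) := fun m x =>
    (continuous_Sn _ f hf r).comp ((continuous_glue r).comp (continuous_id.prodMk continuous_const))
  have hzA : ‖z - l‖ * A ≤ τ / 20 := by
    have h1 : ‖z - l‖ * (A + 1) ≤ τ / 20 := by
      calc _ ≤ τ / (20 * (A + 1)) * (A + 1) := by gcongr
        _ = _ := by field_simp
    nlinarith [norm_nonneg (z - (l : ℂ))]
  have hd : ∀ m x v, ‖Complex.exp (z * s m x v) - Real.exp (l * s m x v)‖
      ≤ τ / 10 * Real.exp (l * s m x v) := by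
    intro m x v
    have e : Complex.exp (z * s m x v) - Real.exp (l * s m x v)
        = Real.exp (l * s m x v) * (Complex.exp ((z - l) * s m x v) - 1) := by
      rw [mul_sub, mul_one, Complex.ofReal_exp, ← Complex.exp_add]
      congr 2
      push_cast
      ring
    have h1 : ‖(z - l) * (s m x v : ℂ)‖ ≤ τ / 20 := by
      rw [norm_mul, Complex.norm_real]
      refine le_trans ?_ hzA
      exact mul_le_mul_of_nonneg_left (hsA m x v) (norm_nonneg _)
    have h2 := Complex.norm_exp_sub_one_le (h1.trans (by linarith))
    rw [e, norm_mul, Complex.norm_real, Real.norm_of_nonneg (Real.exp_pos _).le, mul_comm]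
    refine mul_le_mul_of_nonneg_right ?_ (Real.exp_pos _).le
    linarith
  have hFrec : ∀ m x, Fc σ c f z ((m + 1) * r) x
      = ∫ v, Complex.exp (z * s m x v) * Fc σ c f z (m * r) v ∂σ := by
    intro m x
    rw [add_mul, one_mul]
    exact Fc_rec σ hσ c f hf r hfr z (m * r) x
  have hPrec : ∀ m x, Pr σ c f l ((m + 1) * r) x
      = ∫ v, Real.exp (l * s m x v) * Pr σ c f l (m * r) v ∂σ := by
    intro m x
    rw [add_mul, one_mul]
    exact Pr_rec σ hσ c f hf r hfr l (m * r) x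
  have hstep := fun (m : ℕ) (κ : ℂ) (hκ : κ ≠ 0)
      (hcone : ∀ y, ‖Fc σ c f z (m * r) y - κ * Pr σ c f l (m * r) y‖
        ≤ 1 / 4 * ‖κ‖ * Pr σ c f l (m * r) y) =>
    cone_step σ (Pr σ c f l (m * r)) (Fc σ c f z (m * r)) (Pr_continuous σ c f hf l _)
      (Fc_continuous σ c f hf z _) (Pr_pos σ c f hf l _) (s m) (hsc m) A (hsA m) l z τ (τ / 10)
      hτ (hd m) (by positivity) le_rfl hA0 κ hκ hcone
  simp only [← hFrec, ← hPrec] at hstep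
  have hcones : ∀ m : ℕ, ∃ κ : ℂ, κ ≠ 0 ∧
      ∀ y, ‖Fc σ c f z (m * r) y - κ * Pr σ c f l (m * r) y‖
        ≤ 1 / 4 * ‖κ‖ * Pr σ c f l (m * r) y := by
    intro m
    induction m with
    | zero =>
      refine ⟨1, one_ne_zero, fun y => ?_⟩
      simp [Fc, Pr, Sn]
    | succ m ih =>
      obtain ⟨κ, hκ, hcone⟩ := ih
      obtain ⟨κ', hκ', h1, -⟩ := hstep m κ hκ hcone
      exact ⟨κ', hκ', h1⟩
  have hcentre : ∀ (n : ℕ) (κ : ℂ) (a : ℝ),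
      (∀ y, ‖Fc σ c f z n y - κ * Pr σ c f l n y‖ ≤ a * Pr σ c f l n y) →
      ‖Zc σ c f z n - κ * Zr σ c f l n‖ ≤ a * Zr σ c f l n := by
    intro n κ a h
    have hPc := Pr_continuous σ c f hf l n
    have hFcc := Fc_continuous σ c f hf z n
    have hPi : Integrable (Pr σ c f l n) σ := cont_integrable σ hPc
    have hPi' : Integrable (fun y => κ * (Pr σ c f l n y : ℂ)) σ :=
      cont_integrable σ (by fun_prop)
    rw [Zc_eq σ hσ c f hf, Zr_eq σ hσ c f hf, ← integral_complex_ofReal, ← integral_const_mul,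
      ← integral_sub (cont_integrable σ hFcc) hPi', ← integral_const_mul]
    exact norm_integral_le_of_norm_le (hPi.const_mul _) (Eventually.of_forall h)
  intro m
  obtain ⟨κ, hκ, hcone⟩ := hcones m
  obtain ⟨κ', hκ', -, h2⟩ := hstep m κ hκ hcone
  exact ratio_bound _ _ κ _ _ (Zr_pos σ c f hf l _) (Zr_pos σ c f hf l _) hκ
    (hcentre _ _ _ hcone) (hcentre _ _ _ h2)

lemma pressure_analytic
    (hσ : ∀ (m : ℕ) (a : Fin m → S), σ (cyl a) = (Fintype.card S : ℝ≥0∞)⁻¹ ^ m)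
    (c : ℕ → ℝ) (f : (ℕ → S) → ℝ) (hf : Continuous f) (G M : ℝ)
    (hc : ∀ k, |c k| ≤ G) (hM : ∀ x, |f x| ≤ M) (r : ℕ) (hr : 1 ≤ r)
    (hfr : ∀ x y : ℕ → S, (∀ i, i < r → x i = y i) → f x = f y) (φ : ℝ → ℝ)
    (hφ : ∀ l, Tendsto (fun n : ℕ => Real.log (Zr σ c f l n) / n) atTop (𝓝 (φ l))) (l : ℝ) :
    AnalyticAt ℝ φ l := by
  obtain ⟨δ, hδ, hR⟩ := ratio_mem σ hσ c f hf G M hc hM r hfr l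
  set R : ℕ → ℂ → ℂ := fun m z => Zc σ c f z ((m + 1) * r) / Zc σ c f z (m * r)
        * ((Zr σ c f l (m * r) / Zr σ c f l ((m + 1) * r) : ℝ) : ℂ) with hRdef
  have hslit : Metric.closedBall (1 : ℂ) (5 / 6) ⊆ Complex.slitPlane :=
    (Metric.closedBall_subset_ball (by norm_num)).trans Complex.ball_one_subset_slitPlane
  obtain ⟨B, hB⟩ := (isCompact_closedBall (1 : ℂ) (5 / 6)).exists_bound_of_continuousOn
    (f := Complex.log) (fun w hw => (continuousAt_clog (hslit hw)).continuousWithinAt)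
  have hB0 : 0 ≤ B := (norm_nonneg _).trans (hB 1 (Metric.mem_closedBall_self (by norm_num)))
  set h : ℕ → ℂ → ℂ := fun m z => (∑ k ∈ Finset.range m, Complex.log (R k z)) / (m : ℂ) with hh
  have hrpos : (0 : ℝ) < r := by exact_mod_cast hr
  have hmain : AnalyticAt ℝ (fun x => r * (φ x - φ l)) l := by
    refine vitali_real h _ l δ B hδ ?_ ?_ ?_
    · intro m
      simp only [hh]
      refine DifferentiableOn.div_const (DifferentiableOn.fun_sum fun k _ => ?_) _
      intro z hz
      refine DifferentiableWithinAt.clog ?_ (hslit (hR z hz k).2)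
      have d1 : DifferentiableAt ℂ (fun z => Zc σ c f z ((k + 1) * r)) z :=
        Zc_differentiable σ c f hf _ z
      have d2 : DifferentiableAt ℂ (fun z => Zc σ c f z (k * r)) z :=
        Zc_differentiable σ c f hf _ z
      exact ((d1.fun_div d2 (hR z hz k).1).mul_const _).differentiableWithinAt
    · intro m z hz
      simp only [hh]
      rw [norm_div, Complex.norm_natCast]
      refine div_le_of_le_mul₀ (by positivity) hB0 ?_
      refine (norm_sum_le _ _).trans ((Finset.sum_le_sum fun k _ => hB _ (hR z hz k).2).trans ?_)
      rw [Finset.sum_const, Finset.card_range, nsmul_eq_mul, mul_comm]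
    · intro x hx
      have hval : ∀ m, (h m x).re
          = r * (Real.log (Zr σ c f x (m * r)) / ((m * r : ℕ) : ℝ)
            - Real.log (Zr σ c f l (m * r)) / ((m * r : ℕ) : ℝ)) := by
        intro m
        have h1 : ∀ k, (Complex.log (R k x)).re
            = (Real.log (Zr σ c f x ((k + 1) * r)) - Real.log (Zr σ c f l ((k + 1) * r)))
              - (Real.log (Zr σ c f x (k * r)) - Real.log (Zr σ c f l (k * r))) := by
          intro k
          have q1 := Zr_pos σ c f hf x (k * r)
          have q2 := Zr_pos σ c f hf x ((k + 1) * r)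
          have q3 := Zr_pos σ c f hf l (k * r)
          have q4 := Zr_pos σ c f hf l ((k + 1) * r)
          rw [Complex.log_re]
          simp only [hRdef]
          rw [Zc_ofReal, Zc_ofReal, ← Complex.ofReal_div, ← Complex.ofReal_mul, Complex.norm_real,
            Real.norm_of_nonneg (by positivity), Real.log_mul (by positivity) (by positivity),
            Real.log_div q2.ne' q1.ne', Real.log_div q3.ne' q4.ne']
          ring
        have h0 : ∀ t : ℝ, Zr σ c f t (0 * r) = 1 := by
          intro t
          simp [Zr, Sn]
        simp only [hh]
        rw [Complex.div_natCast_re, Complex.re_sum, Finset.sum_congr rfl fun k _ => h1 k,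
          Finset.sum_range_sub (fun k => Real.log (Zr σ c f x (k * r))
            - Real.log (Zr σ c f l (k * r))), h0, h0]
        push_cast
        rcases Nat.eq_zero_or_pos m with hm | hm
        · simp [hm]
        · have : (0 : ℝ) < m := by exact_mod_cast hm
          field_simp
          simp
      simp only [hval]
      have hmr : Tendsto (fun m : ℕ => m * r) atTop atTop :=
        tendsto_id.atTop_mul_const' hr
      exact (((hφ x).comp hmr).sub ((hφ l).comp hmr)).const_mul _
  have h2 : AnalyticAt ℝ (fun x => (r : ℝ)⁻¹ * (r * (φ x - φ l)) + φ l) l :=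
    (analyticAt_const.mul hmain).add analyticAt_const
  refine h2.congr (Eventually.of_forall fun x => ?_)
  simp only
  field_simp
  ring

end Bern2

/-- Uniquely ergodic weights: for a uniquely ergodic continuous map `Θ`
of a compact metric space, a continuous weight `g` and a continuous `f` depending only
on finitely many coordinates, the pressure exists for every `ω`, is independent of `ω`,
and is real-analytic in `λ`. -/
theorem uniquely_ergodic_pressure {S Ω : Type*} [Fintype S] [TopologicalSpace S]
    [DiscreteTopology S] [MeasurableSpace S] [BorelSpace S] (hq : 2 ≤ Fintype.card S)
    (σ : Measure (ℕ → S)) [IsProbabilityMeasure σ]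
    (hσ : ∀ (m : ℕ) (a : Fin m → S), σ (cyl a) = (Fintype.card S : ℝ≥0∞)⁻¹ ^ m)
    [MetricSpace Ω] [CompactSpace Ω] [MeasurableSpace Ω] [BorelSpace Ω]
    (Θ : Ω → Ω) (hΘc : Continuous Θ)
    (hUE : ∃! m : ProbabilityMeasure Ω,
      MeasurePreserving Θ (m : Measure Ω) (m : Measure Ω))
    (g : Ω → ℝ) (hg : Continuous g)
    (r : ℕ) (hr : 1 ≤ r) (f : (ℕ → S) → ℝ) (hfc : Continuous f)
    (hfr : ∀ x y : ℕ → S, (∀ i, i < r → x i = y i) → f x = f y) :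
    ∃ φf : ℝ → ℝ,
      (∀ (ω : Ω) (lam : ℝ),
        Tendsto (fun n : ℕ =>
            Real.log (∫ x, Real.exp
              (lam * ∑ k ∈ Finset.range n, g (Θ^[k] ω) * f (shift^[k] x)) ∂σ) / n)
          atTop (𝓝 (φf lam))) ∧
      ∀ t : ℝ, AnalyticAt ℝ φf t := by
  obtain ⟨m, -, huniq⟩ := hUE
  have hX : Nonempty (ℕ → S) := by
    have : 0 < Fintype.card S := by omega
    rw [Fintype.card_pos_iff] at this
    infer_instance
  obtain ⟨x0⟩ := hX
  have hΩ : Nonempty Ω := by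
    by_contra hne
    rw [not_nonempty_iff] at hne
    have := (inferInstance : IsProbabilityMeasure (m : Measure Ω)).measure_univ
    simp [Set.eq_empty_of_isEmpty] at this
  obtain ⟨ω0⟩ := hΩ
  obtain ⟨G, hG⟩ := isCompact_univ.exists_bound_of_continuousOn hg.continuousOn
  obtain ⟨M, hM⟩ := isCompact_univ.exists_bound_of_continuousOn hfc.continuousOn
  have hG' : ∀ ω, |g ω| ≤ G := fun ω => hG ω (Set.mem_univ _)
  have hM' : ∀ x, |f x| ≤ M := fun x => hM x (Set.mem_univ _)
  have hG0 : 0 ≤ G := (abs_nonneg _).trans (hG' ω0)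
  have hM0 : 0 ≤ M := (abs_nonneg _).trans (hM' x0)
  have hex : ∀ l : ℝ, ∃ L : ℝ, ∀ ω, Tendsto (fun n : ℕ =>
      Real.log (Zr σ (fun k => g (Θ^[k] ω)) f l n) / n) atTop (𝓝 L) := by
    intro l
    refine quasi_additive_limit Θ hΘc m huniq
      (fun n ω => Real.log (Zr σ (fun k => g (Θ^[k] ω)) f l n)) (|l| * (G * M))
      (|l| * (r * (2 * (G * M)))) (by positivity) ?_ ?_ ?_
    · intro n
      refine Continuous.log ?_ fun ω => (Zr_pos σ _ f hfc l n).ne'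
      unfold Zr
      refine continuous_integral_param σ _ ?_
      have : Continuous fun p : Ω × (ℕ → S) => Sn (fun k => g (Θ^[k] p.1)) f n p.2 := by
        unfold Sn
        refine continuous_finsetSum _ fun k _ => ?_
        exact (hg.comp ((hΘc.iterate k).comp continuous_fst)).mul
          (hfc.comp ((continuous_shift_iter k).comp continuous_snd))
      exact Real.continuous_exp.comp (continuous_const.mul this)
    · intro n ω
      exact Zr_bound σ _ f hfc G M (fun k => hG' _) hM' l n
    · intro n k ω
      have := Zr_quasi σ hσ (fun k => g (Θ^[k] ω)) f hfc G M (fun k => hG' _) hM' r hfr l n k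
      have e : (fun j => g (Θ^[n + j] ω)) = fun j => g (Θ^[j] (Θ^[n] ω)) := by
        ext j
        rw [add_comm, Function.iterate_add_apply]
      simp only [e] at this
      exact this
  choose φ hφ using hex
  refine ⟨φ, fun ω l => hφ l ω, fun t => ?_⟩
  exact pressure_analytic σ hσ (fun k => g (Θ^[k] ω0)) f hfc G M (fun k => hG' _) hM' r hr hfr φ
    (fun l => hφ l ω0) t
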